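/- Let a, b, c, n ∈ ℝ and ε > 0, and let δ_ε(t) = 1/ε for 0 ≤ t ≤ ε and δ_ε(t) = 0 otherwise. Define g_ε(t₁, t₂) = ∫_ℝ ∫_ℝ c e^{a τ₂} n e^{a τ₁} b · 1_{(0,∞)}(τ₁) 1_{(0,∞)}(τ₂) · δ_ε(t₂ − τ₂) δ_ε(t₁ + t₂ − τ₂ − τ₁) dτ₂ dτ₁. Then for all s₁, s₂ ∈ ℂ with Re(s₁) > a, Re(s₂) > a, s₁ ≠ 0 and s₂ ≠ s₁: ∫_{t₂=0}^∞ ∫_{t₁=−t₂}^∞ g_ε(t₁, t₂) e^{−s₁ t₁ − s₂ t₂} dt₁ dt₂ = c·n·b · (s₂ − a)^{−1} (s₁ − a)^{−1} · ((1 − e^{−s₁ ε})/(s₁ ε)) · ((1 − e^{−(s₂ − s₁) ε})/((s₂ − s₁) ε)). -/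

import Mathlib

open MeasureTheory Set

/-- The nascent delta function of amplitude `1/ε` and duration `ε`. -/
noncomputable def nascentDelta (ε t : ℝ) : ℝ := if 0 ≤ t ∧ t ≤ ε then ε⁻¹ else 0

open scoped Convolution

/-- The causal exponential `t ↦ e^{-zt}` on the positive half-line, extended by zero. -/
noncomputable def causalExp (z : ℂ) : ℝ → ℂ :=
  (Ioi (0 : ℝ)).indicator fun t => Complex.exp (-z * t)

/-- The nascent delta function weighted by the Laplace kernel `e^{-zt}`. -/
noncomputable def weightedDelta (ε : ℝ) (z : ℂ) (t : ℝ) : ℂ :=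
  nascentDelta ε t * Complex.exp (-z * t)

theorem integrable_causalExp {z : ℂ} (hz : 0 < z.re) : Integrable (causalExp z) :=
  (integrable_indicator_iff measurableSet_Ioi).2
    (integrableOn_exp_mul_complex_Ioi (by simpa using hz) 0)

theorem integral_causalExp {z : ℂ} (hz : 0 < z.re) : ∫ t, causalExp z t = z⁻¹ := by
  rw [causalExp, integral_indicator measurableSet_Ioi,
    integral_exp_mul_complex_Ioi (by simpa using hz) 0]
  simp [neg_div_neg_eq]

theorem weightedDelta_eq_indicator (ε : ℝ) (z : ℂ) :
    weightedDelta ε z =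
      (Icc 0 ε).indicator fun t : ℝ => (ε⁻¹ : ℂ) * Complex.exp (-z * t) := by
  funext t
  by_cases ht : 0 ≤ t ∧ t ≤ ε <;> simp [weightedDelta, nascentDelta, indicator, ht]

theorem integrable_weightedDelta (ε : ℝ) (z : ℂ) : Integrable (weightedDelta ε z) := by
  rw [weightedDelta_eq_indicator, integrable_indicator_iff measurableSet_Icc]
  exact Continuous.integrableOn_Icc (by fun_prop)

theorem exists_norm_weightedDelta_le (ε : ℝ) (z : ℂ) : ∃ C, ∀ t, ‖weightedDelta ε z t‖ ≤ C := by
  obtain ⟨C, hC⟩ := isCompact_Icc.exists_bound_of_continuousOn (s := Icc 0 ε)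
    (f := fun t : ℝ => (ε⁻¹ : ℂ) * Complex.exp (-z * t)) (by fun_prop)
  refine ⟨max C 0, fun t => ?_⟩
  rw [weightedDelta_eq_indicator]
  by_cases ht : t ∈ Icc 0 ε
  · rw [indicator_of_mem ht]
    exact (hC t ht).trans (le_max_left _ _)
  · simp [indicator_of_notMem ht]

theorem integral_weightedDelta {ε : ℝ} (hε : 0 < ε) {z : ℂ} (hz : z ≠ 0) :
    ∫ t, weightedDelta ε z t = (1 - Complex.exp (-(z * ε))) / (z * ε) := by
  have hε' : (ε : ℂ) ≠ 0 := by exact_mod_cast hε.ne'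
  rw [weightedDelta_eq_indicator, integral_indicator measurableSet_Icc,
    integral_Icc_eq_integral_Ioc, ← intervalIntegral.integral_of_le hε.le,
    intervalIntegral.integral_const_mul, integral_exp_mul_complex (neg_ne_zero.2 hz)]
  simp only [Complex.ofReal_zero, mul_zero, Complex.exp_zero, neg_mul]
  field_simp
  ring

theorem nascentDelta_of_neg (ε : ℝ) {t : ℝ} (ht : t < 0) : nascentDelta ε t = 0 :=
  if_neg fun h => ht.not_ge h.1

/-- The response integral multiplied by the Laplace kernel is an iterated convolution. -/
theorem response_mul_exp_eq_convolution (a b c n ε : ℝ) (s₁ s₂ : ℂ) (t₁ t₂ : ℝ) :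
    ((∫ τ₁ : ℝ, ∫ τ₂ : ℝ,
        c * Real.exp (a * τ₂) * n * Real.exp (a * τ₁) * b *
          (Ioi (0 : ℝ)).indicator (fun _ => (1 : ℝ)) τ₁ *
          (Ioi (0 : ℝ)).indicator (fun _ => (1 : ℝ)) τ₂ *
          nascentDelta ε (t₂ - τ₂) * nascentDelta ε (t₁ + t₂ - τ₂ - τ₁) : ℝ) : ℂ) *
        Complex.exp (-(s₁ * t₁) - s₂ * t₂) =
      (c * n * b : ℝ) *
        (causalExp (s₁ - a) ⋆[ContinuousLinearMap.mul ℂ ℂ, volume]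
          ((fun τ => causalExp (s₂ - a) τ * weightedDelta ε (s₂ - s₁) (t₂ - τ))
            ⋆[ContinuousLinearMap.mul ℂ ℂ, volume] weightedDelta ε s₁)) (t₁ + t₂) := by
  simp only [convolution_mul]
  simp only [← integral_complex_ofReal, ← integral_const_mul, ← integral_mul_const]
  refine integral_congr_ae (.of_forall fun τ₁ => integral_congr_ae (.of_forall fun τ₂ => ?_))
  by_cases h₁ : 0 < τ₁
  swap
  · simp [causalExp, h₁]
  by_cases h₂ : 0 < τ₂
  swap
  · simp [causalExp, h₂]
  have hexp : Complex.exp (a * τ₂) * Complex.exp (a * τ₁) *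
        Complex.exp (-(s₁ * t₁) - s₂ * t₂) =
      Complex.exp (-(s₁ - a) * τ₁) * Complex.exp (-(s₂ - a) * τ₂) *
        Complex.exp (-(s₂ - s₁) * (t₂ - τ₂)) *
        Complex.exp (-s₁ * (t₁ + t₂ - τ₁ - τ₂)) := by
    simp only [← Complex.exp_add]
    congr 1
    ring
  have hsub : t₁ + t₂ - τ₂ - τ₁ = t₁ + t₂ - τ₁ - τ₂ := by ring
  simp only [causalExp, weightedDelta, indicator_of_mem (mem_Ioi.2 h₁),
    indicator_of_mem (mem_Ioi.2 h₂), hsub]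
  push_cast
  linear_combination (c * n * b * nascentDelta ε (t₂ - τ₂) *
    nascentDelta ε (t₁ + t₂ - τ₁ - τ₂) : ℂ) * hexp

theorem stmt18 (a b c n ε : ℝ) (hε : 0 < ε)
    (g : ℝ → ℝ → ℝ)
    (hg : ∀ t₁ t₂ : ℝ, g t₁ t₂ =
      ∫ τ₁ : ℝ, ∫ τ₂ : ℝ,
        c * Real.exp (a * τ₂) * n * Real.exp (a * τ₁) * b *
          (Ioi (0 : ℝ)).indicator (fun _ => (1 : ℝ)) τ₁ *
          (Ioi (0 : ℝ)).indicator (fun _ => (1 : ℝ)) τ₂ *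
          nascentDelta ε (t₂ - τ₂) * nascentDelta ε (t₁ + t₂ - τ₂ - τ₁))
    (s₁ s₂ : ℂ) (h₁ : a < s₁.re) (h₂ : a < s₂.re)
    (hs₁ : s₁ ≠ 0) (hs₂₁ : s₂ ≠ s₁) :
    ∫ t₂ : ℝ in Ioi 0, ∫ t₁ : ℝ in Ioi (-t₂),
        (g t₁ t₂ : ℂ) * Complex.exp (-(s₁ * t₁) - s₂ * t₂) =
      (c * n * b : ℝ) * (s₂ - a)⁻¹ * (s₁ - a)⁻¹ *
        ((1 - Complex.exp (-(s₁ * ε))) / (s₁ * ε)) *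
        ((1 - Complex.exp (-((s₂ - s₁) * ε))) / ((s₂ - s₁) * ε)) := by
  have hz₁ : 0 < (s₁ - a).re := by simpa using h₁
  have hz₂ : 0 < (s₂ - a).re := by simpa using h₂
  have hg_zero : ∀ t₁ t₂ : ℝ, t₂ ≤ 0 ∨ t₁ + t₂ ≤ 0 → g t₁ t₂ = 0 := by
    intro t₁ t₂ ht
    rw [hg]
    refine integral_eq_zero_of_ae (.of_forall fun τ₁ => integral_eq_zero_of_ae
      (.of_forall fun τ₂ => ?_))
    by_cases hτ₁ : 0 < τ₁
    swap
    · simp [hτ₁]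
    by_cases hτ₂ : 0 < τ₂
    swap
    · simp [hτ₂]
    rcases ht with ht | ht
    · simp [nascentDelta_of_neg ε (show t₂ - τ₂ < 0 by linarith)]
    · simp [nascentDelta_of_neg ε (show t₁ + t₂ - τ₂ - τ₁ < 0 by linarith)]
  have hinner : ∀ t₂ : ℝ, ∫ t₁ : ℝ in Ioi (-t₂),
      (g t₁ t₂ : ℂ) * Complex.exp (-(s₁ * t₁) - s₂ * t₂) =
        (c * n * b : ℝ) * ((s₁ - a)⁻¹ *
          ((causalExp (s₂ - a) ⋆[ContinuousLinearMap.mul ℂ ℂ, volume]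
            weightedDelta ε (s₂ - s₁)) t₂ *
          ((1 - Complex.exp (-(s₁ * ε))) / (s₁ * ε)))) := by
    intro t₂
    have hβ : Integrable fun τ : ℝ =>
        causalExp (s₂ - a) τ * weightedDelta ε (s₂ - s₁) (t₂ - τ) := by
      obtain ⟨C, hC⟩ := exists_norm_weightedDelta_le ε (s₂ - s₁)
      exact (integrable_causalExp hz₂).mul_bdd
        ((integrable_weightedDelta ε (s₂ - s₁)).comp_sub_left t₂).aestronglyMeasurable
        (.of_forall fun τ => hC (t₂ - τ))
    rw [setIntegral_eq_integral_of_forall_compl_eq_zero fun t₁ ht₁ => by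
      rw [mem_Ioi, not_lt] at ht₁
      simp [hg_zero t₁ t₂ (.inr (by linarith))]]
    simp_rw [hg, response_mul_exp_eq_convolution]
    rw [integral_const_mul, integral_add_right_eq_self (fun v : ℝ => convolution _ _ _ _ v),
      integral_convolution _ (integrable_causalExp hz₁)
        (hβ.integrable_convolution _ (integrable_weightedDelta ε s₁)),
      integral_convolution _ hβ (integrable_weightedDelta ε s₁),
      integral_causalExp hz₁, integral_weightedDelta hε hs₁]
    rfl
  rw [setIntegral_eq_integral_of_forall_compl_eq_zero fun t₂ ht₂ => by
    rw [mem_Ioi, not_lt] at ht₂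
    simp [hg_zero _ t₂ (.inl ht₂)]]
  simp_rw [hinner]
  rw [integral_const_mul, integral_const_mul, integral_mul_const,
    integral_convolution _ (integrable_causalExp hz₂) (integrable_weightedDelta ε (s₂ - s₁)),
    integral_causalExp hz₂, integral_weightedDelta hε (sub_ne_zero.2 hs₂₁),
    ContinuousLinearMap.mul_apply']
  ring
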